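/- Let p be a prime, let r and q be powers of p, let a and b be positive integers coprime to p and to each other, let m ≥ 1, and let F be the finite field with r^m elements. Fix a nontrivial additive character ψ_p of F_p and set ψ(x) = ψ_p(Tr_{F/F_p}(x)). For c ∈ F let N(c) denote the number of pairs (x,y) ∈ F × F with x^a + y^b = c. Then Σ_{β∈F^×} (r^m − N(β^q − β)) = − Σ_{α∈F, α^q=α} Σ_{λ₁} Σ_{λ₂} Σ_{(w,z)∈F×F} λ₁(z)·λ₂(w−z)·ψ(αw), where λ₁ ranges over the nontrivial multiplicative characters of F with λ₁^a trivial and λ₂ ranges over the nontrivial multiplicative characters of F with λ₂^b trivial. -/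

import Mathlib

open scoped Classical

attribute [local instance] ZMod.algebra

noncomputable instance (F : Type*) [Field F] [Fintype F] : Fintype (MulChar F ℂ) :=
  Fintype.ofFinite _

namespace MulChar

variable {F : Type*} [Field F] [Fintype F]

/-- Orthogonality for the complex multiplicative characters of a finite field. -/
theorem sum_apply_eq_ite (z : F) :
    ∑ χ : MulChar F ℂ, χ z = if z = 1 then (Fintype.card Fˣ : ℂ) else 0 := by
  split_ifs with h
  · simp only [h, map_one, Finset.sum_const, Finset.card_univ, nsmul_eq_mul, mul_one]
    rw [← Nat.card_eq_fintype_card, card_eq_card_units_of_hasEnoughRootsOfUnity F ℂ,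
      Nat.card_eq_fintype_card]
  · obtain ⟨χ, hχ⟩ := exists_apply_ne_one_of_hasEnoughRootsOfUnity F ℂ h
    refine eq_zero_of_mul_eq_self_left hχ ?_
    simp only [Finset.mul_sum, ← mul_apply]
    exact Fintype.sum_bijective _ (Group.mulLeft_bijective χ) _ _ fun χ' ↦ rfl

theorem sum_eq_ite (χ : MulChar F ℂ) :
    ∑ x, χ x = if χ = 1 then (Fintype.card Fˣ : ℂ) else 0 := by
  split_ifs with h
  · rw [h, sum_one_eq_card_units]
  · exact sum_eq_zero_of_ne_one h

/-- The number of `a`-th roots of `z`, as a sum over nontrivial characters of order dividing `a`. -/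
theorem card_pow_eq {a : ℕ} (ha : a ≠ 0) (z : F) :
    ((Finset.univ.filter fun x : F => x ^ a = z).card : ℂ) =
      1 + ∑ χ ∈ Finset.univ.filter (fun χ : MulChar F ℂ => χ ≠ 1 ∧ χ ^ a = 1), χ z := by
  rcases eq_or_ne z 0 with rfl | hz
  · have h0 : (Finset.univ.filter fun x : F => x ^ a = 0) = {0} := by
      ext x
      simp [ha]
    rw [h0]
    simp
  have hcard : (Fintype.card Fˣ : ℂ) ≠ 0 := by simp
  have hsum : ∑ χ ∈ Finset.univ.filter (fun χ : MulChar F ℂ => χ ^ a = 1), χ z =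
      1 + ∑ χ ∈ Finset.univ.filter (fun χ : MulChar F ℂ => χ ≠ 1 ∧ χ ^ a = 1), χ z := by
    have h1 : (1 : MulChar F ℂ) ∈ Finset.univ.filter (fun χ : MulChar F ℂ => χ ^ a = 1) := by
      simp
    rw [← Finset.add_sum_erase _ _ h1, one_apply hz.isUnit]
    congr 2
    ext χ
    simp
  rw [← hsum]
  refine mul_left_cancel₀ hcard ?_
  calc (Fintype.card Fˣ : ℂ) * ((Finset.univ.filter fun x : F => x ^ a = z).card : ℂ)
      = ∑ x : F, ∑ χ : MulChar F ℂ, χ (z * x⁻¹ ^ a) := by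
        simp only [sum_apply_eq_ite]
        rw [← Finset.sum_filter, Finset.sum_const, nsmul_eq_mul, mul_comm]
        congr 3
        ext x
        simp only [Finset.mem_filter, Finset.mem_univ, true_and]
        rcases eq_or_ne x 0 with rfl | hx
        · simp [ha, hz.symm]
        · rw [inv_pow, mul_inv_eq_one₀ (pow_ne_zero a hx), eq_comm]
    _ = ∑ χ : MulChar F ℂ, χ z * ∑ x : F, (χ ^ a)⁻¹ x := by
        rw [Finset.sum_comm]
        refine Finset.sum_congr rfl fun χ _ => ?_
        rw [Finset.mul_sum]
        refine Finset.sum_congr rfl fun x _ => ?_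
        rw [map_mul, map_pow, inv_apply', pow_apply' χ ha]
    _ = _ := by
        simp only [sum_eq_ite, inv_eq_one, Finset.sum_filter, Finset.mul_sum]
        refine Finset.sum_congr rfl fun χ _ => ?_
        split_ifs <;> ring

theorem sum_comp_pow {a : ℕ} (ha : a ≠ 0) (f : F → ℂ) :
    ∑ x : F, f (x ^ a) = ∑ z, f z +
      ∑ χ ∈ Finset.univ.filter (fun χ : MulChar F ℂ => χ ≠ 1 ∧ χ ^ a = 1), ∑ z, χ z * f z := by
  rw [← Finset.sum_fiberwise Finset.univ (fun x : F => x ^ a), Finset.sum_comm,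
    ← Finset.sum_add_distrib]
  refine Finset.sum_congr rfl fun z _ => ?_
  rw [← Finset.sum_mul, ← one_add_mul, ← card_pow_eq ha, ← nsmul_eq_mul, ← Finset.sum_const]
  exact Finset.sum_congr rfl fun x hx => by rw [(Finset.mem_filter.mp hx).2]

/-- The number of solutions of `x ^ a + y ^ b = c` in terms of Jacobi-type sums. -/
theorem card_pow_add_pow_eq {a b : ℕ} (ha : a ≠ 0) (hb : b ≠ 0) (c : F) :
    ((Finset.univ.filter fun xy : F × F => xy.1 ^ a + xy.2 ^ b = c).card : ℂ) =
      Fintype.card F +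
        ∑ χ ∈ Finset.univ.filter (fun χ : MulChar F ℂ => χ ≠ 1 ∧ χ ^ a = 1),
          ∑ φ ∈ Finset.univ.filter (fun χ : MulChar F ℂ => χ ≠ 1 ∧ χ ^ b = 1),
            ∑ z, χ z * φ (c - z) := by
  have hcount : ((Finset.univ.filter fun xy : F × F => xy.1 ^ a + xy.2 ^ b = c).card : ℂ) =
      ∑ x : F, (1 + ∑ φ ∈ Finset.univ.filter (fun χ : MulChar F ℂ => χ ≠ 1 ∧ χ ^ b = 1),
        φ (c - x ^ a)) := by
    rw [Finset.card_filter, Nat.cast_sum, Fintype.sum_prod_type]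
    refine Finset.sum_congr rfl fun x _ => ?_
    rw [← card_pow_eq hb, Finset.card_filter, Nat.cast_sum]
    refine Finset.sum_congr rfl fun y _ => ?_
    simp only [eq_sub_iff_add_eq']
  rw [hcount, sum_comp_pow ha (fun t => 1 + ∑ φ ∈ Finset.univ.filter
    (fun χ : MulChar F ℂ => χ ≠ 1 ∧ χ ^ b = 1), φ (c - t))]
  congr 1
  · rw [Finset.sum_add_distrib, Finset.sum_comm, Finset.sum_eq_zero (s := Finset.filter _ _)]
    · simp
    · intro φ hφ
      rw [← sum_eq_zero_of_ne_one (Finset.mem_filter.mp hφ).2.1]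
      exact Equiv.sum_comp (Equiv.subLeft c) φ
  · refine Finset.sum_congr rfl fun χ hχ => ?_
    simp only [mul_add, mul_one, Finset.sum_add_distrib, Finset.mul_sum,
      sum_eq_zero_of_ne_one (Finset.mem_filter.mp hχ).2.1, zero_add]
    exact Finset.sum_comm

/-- If `χ` and `φ` are nontrivial of coprime exponents, then `∑ z, χ z * φ (-z)` vanishes. -/
theorem sum_mul_apply_neg_eq_zero {a b : ℕ} (hab : a.Coprime b) {χ φ : MulChar F ℂ}
    (hχ : χ ≠ 1) (hχa : χ ^ a = 1) (hφb : φ ^ b = 1) : ∑ z, χ z * φ (-z) = 0 := by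
  have hne : χ * φ ≠ 1 := by
    intro h
    refine hχ (orderOf_eq_one_iff.mp (Nat.eq_one_of_dvd_coprimes hab (orderOf_dvd_of_pow_eq_one hχa)
      (orderOf_dvd_of_pow_eq_one ?_)))
    rw [eq_inv_of_mul_eq_one_left h, inv_pow, hφb, inv_one]
  calc ∑ z, χ z * φ (-z) = φ (-1) * ∑ z, (χ * φ) z := by
        rw [Finset.mul_sum]
        refine Finset.sum_congr rfl fun z _ => ?_
        rw [mul_apply, ← neg_one_mul z, map_mul]
        ring
    _ = 0 := by rw [sum_eq_zero_of_ne_one hne, mul_zero]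

end MulChar

namespace AddChar

variable {F : Type*} [Field F] [Fintype F]

/-- The fibres of the Artin–Schreier map `β ↦ σ β - β` counted by the characters `x ↦ ψ (α * x)`
with `σ α = α`, for an automorphism `σ` of the field fixing `ψ`. -/
theorem sum_fixed_apply_mul {ψ : AddChar F ℂ} (hψ : ψ.IsPrimitive) (σ : F ≃+* F)
    (hσ : ∀ x, ψ (σ x) = ψ x) (w : F) :
    ∑ α ∈ Finset.univ.filter (fun α : F => σ α = α), ψ (α * w) =
      ((Finset.univ.filter fun β : F => σ β - β = w).card : ℂ) := by
  have hcard : (Fintype.card F : ℂ) ≠ 0 := by simp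
  refine mul_left_cancel₀ hcard ?_
  calc (Fintype.card F : ℂ) * ∑ α ∈ Finset.univ.filter (fun α : F => σ α = α), ψ (α * w)
      = ∑ α : F, ψ (α * w) * ∑ β : F, ψ (β * (σ α - α)) := by
        simp only [sum_mulShift _ hψ, sub_eq_zero, Finset.sum_filter, Finset.mul_sum]
        refine Finset.sum_congr rfl fun α _ => ?_
        split_ifs <;> simp [mul_comm]
    _ = ∑ α : F, ψ (α * w) * ∑ β : F, ψ (α * -(σ β - β)) := by
        refine Finset.sum_congr rfl fun α _ => congrArg _ ?_
        rw [← Equiv.sum_comp σ.toEquiv fun β => ψ (β * (σ α - α))]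
        refine Finset.sum_congr rfl fun β _ => ?_
        have h : ψ (σ β * σ α) = ψ (β * α) := by rw [← map_mul, hσ]
        simp only [RingEquiv.toEquiv_eq_coe, EquivLike.coe_coe, mul_sub, neg_sub, map_sub_eq_div, h]
        rw [mul_comm β, mul_comm (σ β)]
    _ = ∑ β : F, ∑ α : F, ψ (α * (w - (σ β - β))) := by
        simp only [Finset.mul_sum, ← map_add_eq_mul, ← mul_add, ← sub_eq_add_neg]
        exact Finset.sum_comm
    _ = _ := by
        simp only [sum_mulShift _ hψ, sub_eq_zero, Finset.card_filter, Nat.cast_sum,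
          Finset.mul_sum]
        refine Finset.sum_congr rfl fun β _ => ?_
        simp only [eq_comm (a := w)]
        split_ifs <;> simp

end AddChar

/-- The sum of the Frobenius traces `∑_{β ∈ F^×} (r^m − N(β^q − β))`, where `N(c)` is the number
of affine points of `x^a + y^b = c` over the field `F` with `r^m` elements, equals the negated
sum of the character sums `∑_{(w,z)} λ₁(z)·λ₂(w−z)·ψ(αw)` over `α ∈ F ∩ F_q` and over pairs of
nontrivial multiplicative characters `λ₁, λ₂` with `λ₁^a` and `λ₂^b` trivial. -/
theorem stmt3 (p : ℕ) [Fact p.Prime] (r q : ℕ)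
    (hr : ∃ k : ℕ, r = p ^ k) (hq : ∃ k : ℕ, q = p ^ k)
    (a b : ℕ) (ha : 0 < a) (hb : 0 < b)
    (hap : Nat.Coprime a p) (hbp : Nat.Coprime b p) (hab : Nat.Coprime a b)
    (m : ℕ) (hm : 1 ≤ m)
    (F : Type*) [Field F] [Fintype F] [CharP F p] (hF : Fintype.card F = r ^ m)
    (ψp : AddChar (ZMod p) ℂ) (hψ : ψp ≠ 1) :
    ∑ β ∈ Finset.univ.filter (fun β : F => β ≠ 0),
        ((r : ℂ) ^ m
          - ((Finset.univ.filter
              (fun xy : F × F => xy.1 ^ a + xy.2 ^ b = β ^ q - β)).card : ℂ)) =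
      - ∑ α ∈ Finset.univ.filter (fun α : F => α ^ q = α),
          ∑ lam₁ ∈ Finset.univ.filter (fun χ : MulChar F ℂ => χ ≠ 1 ∧ χ ^ a = 1),
            ∑ lam₂ ∈ Finset.univ.filter (fun χ : MulChar F ℂ => χ ≠ 1 ∧ χ ^ b = 1),
              ∑ w : F, ∑ z : F,
                lam₁ z * lam₂ (w - z) * ψp (Algebra.trace (ZMod p) F (α * w)) := by
  obtain ⟨k, rfl⟩ := hq
  let σ : F ≃+* F := iterateFrobeniusEquiv F p k
  have hσ (x : F) : σ x = x ^ p ^ k := iterateFrobeniusEquiv_def F p k x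
  let ψ : AddChar F ℂ := ψp.compAddMonoidHom (Algebra.trace (ZMod p) F).toAddMonoidHom
  have hψ_apply (x : F) : ψ x = ψp (Algebra.trace (ZMod p) F x) := rfl
  have hprim : ψ.IsPrimitive := by
    refine AddChar.IsPrimitive.of_ne_one fun h => hψ ?_
    ext t
    obtain ⟨x, rfl⟩ := Algebra.trace_surjective (ZMod p) F t
    rw [← hψ_apply, h, AddChar.one_apply, AddChar.one_apply]
  have hinv (x : F) : ψ (σ x) = ψ x := by
    let e : F ≃ₐ[ZMod p] F := AlgEquiv.ofRingEquiv (f := σ) fun t =>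
      RingHom.congr_fun (Subsingleton.elim ((σ : F →+* F).comp (algebraMap (ZMod p) F))
        (algebraMap (ZMod p) F)) t
    rw [hψ_apply, hψ_apply]
    exact congrArg ψp (Algebra.trace_eq_of_algEquiv e x)
  have hcard : (Fintype.card F : ℂ) = (r : ℂ) ^ m := by rw [hF, Nat.cast_pow]
  let A := Finset.univ.filter (fun χ : MulChar F ℂ => χ ≠ 1 ∧ χ ^ a = 1)
  let B := Finset.univ.filter (fun χ : MulChar F ℂ => χ ≠ 1 ∧ χ ^ b = 1)
  let S : F → ℂ := fun c => ∑ χ ∈ A, ∑ φ ∈ B, ∑ z, χ z * φ (c - z)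
  have hS0 : S 0 = 0 := by
    refine Finset.sum_eq_zero fun χ hχ => Finset.sum_eq_zero fun φ hφ => ?_
    simp only [zero_sub]
    have hχ' := (Finset.mem_filter.mp hχ).2
    exact MulChar.sum_mul_apply_neg_eq_zero hab hχ'.1 hχ'.2 (Finset.mem_filter.mp hφ).2.2
  calc _ = ∑ β ∈ Finset.univ.filter (fun β : F => β ≠ 0), -S (σ β - β) := by
        refine Finset.sum_congr rfl fun β _ => ?_
        rw [MulChar.card_pow_add_pow_eq ha.ne' hb.ne', hcard, hσ]
        simp only [S, A, B]
        ring
    _ = -∑ β : F, S (σ β - β) := by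
        rw [Finset.sum_neg_distrib, Finset.sum_filter_of_ne]
        rintro β _ h rfl
        exact h (by simp [hS0])
    _ = -∑ w : F, S w * ∑ α ∈ Finset.univ.filter (fun α : F => σ α = α), ψ (α * w) := by
        rw [← Finset.sum_fiberwise Finset.univ (fun β : F => σ β - β)]
        congr 1
        refine Finset.sum_congr rfl fun w _ => ?_
        rw [AddChar.sum_fixed_apply_mul hprim σ hinv, mul_comm, ← nsmul_eq_mul, ← Finset.sum_const]
        exact Finset.sum_congr rfl fun β hβ => by rw [(Finset.mem_filter.mp hβ).2]
    _ = -∑ α ∈ Finset.univ.filter (fun α : F => σ α = α), ∑ w : F, S w * ψ (α * w) := by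
        simp only [Finset.mul_sum]
        rw [Finset.sum_comm]
    _ = _ := by
        simp only [hσ]
        congr 1
        refine Finset.sum_congr rfl fun α _ => ?_
        simp only [S, Finset.sum_mul, hψ_apply]
        rw [Finset.sum_comm]
        refine Finset.sum_congr rfl fun χ _ => ?_
        rw [Finset.sum_comm]
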